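/- Let (𝒳,d) be a metric space carrying a geodesic CAT(0) structure, let (Ω,ℱ,P) be a probability space, let δ : Ω → 𝒳 be a Borel random object with E[d(z,δ)²] < ∞ for all z ∈ 𝒳, and let 𝒞 be a set of Borel random objects Ω → 𝒳 with square-integrable distances that is geodesically convex (if Y₁, Y₂ ∈ 𝒞 and t ∈ [0,1] then ω ↦ [Y₁(ω),Y₂(ω)]_t belongs to 𝒞) and contains every constant map. Suppose δ̃ ∈ 𝒞 minimizes Y ↦ E[d(δ,Y)²] over 𝒞. Then for every θ ∈ 𝒳, E[d(δ,θ)²] ≥ E[d(δ,δ̃)²] + E[d(δ̃,θ)²]; in particular E[d(δ̃,θ)²] ≤ E[d(δ,θ)²], so replacing an estimator by its projection onto 𝒞 (e.g. replacing a randomized estimator by a conditional Fréchet mean) never increases the squared-distance risk. -/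

import Mathlib

open MeasureTheory ProbabilityTheory Filter

/-- A geodesic CAT(0) structure on a metric space `X`: a geodesic selection
`γ x y t` (`t ∈ [0,1]`) with endpoints `x`, `y`, affinely parameterized,
satisfying the CAT(0) comparison inequality. -/
structure GeodesicCAT0 (X : Type*) [MetricSpace X] where
  γ : X → X → ℝ → X
  γ_zero : ∀ x y : X, γ x y 0 = x
  γ_one : ∀ x y : X, γ x y 1 = y
  dist_γ : ∀ x y : X, ∀ s ∈ Set.Icc (0:ℝ) 1, ∀ t ∈ Set.Icc (0:ℝ) 1,
    dist (γ x y s) (γ x y t) = |s - t| * dist x y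
  cat0 : ∀ x y z : X, ∀ t ∈ Set.Icc (0:ℝ) 1,
    dist (γ x y t) z ^ 2 ≤
      (1 - t) * dist x z ^ 2 + t * dist y z ^ 2 - t * (1 - t) * dist x y ^ 2

/-- Joint Borel measurability of the geodesic map of a `GeodesicCAT0` structure. -/
def GeodesicCAT0.MeasurableGeo {X : Type*} [MetricSpace X] [MeasurableSpace X]
    (G : GeodesicCAT0 X) : Prop :=
  Measurable fun p : X × X × ℝ => G.γ p.1 p.2.1 p.2.2

/-- `θ` is a Fréchet mean of the Borel random object `f` (defined on a probability
space `(Ω, P)`, taking values in a metric space): it minimizes `z ↦ E[d(z, f)²]`. -/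
def IsFrechetMeanRV {Ω X : Type*} [MetricSpace X] [MeasurableSpace Ω]
    (P : Measure Ω) (f : Ω → X) (θ : X) : Prop :=
  ∀ z : X, ∫ ω, dist θ (f ω) ^ 2 ∂P ≤ ∫ ω, dist z (f ω) ^ 2 ∂P

/-- `θ` is a Fréchet mean of the Borel probability measure `P` on a metric space:
it minimizes `z ↦ ∫ d(z,u)² dP(u)`. -/
def IsFrechetMean {X : Type*} [MetricSpace X] [MeasurableSpace X]
    (P : Measure X) (θ : X) : Prop :=
  ∀ z : X, ∫ u, dist θ u ^ 2 ∂P ≤ ∫ u, dist z u ^ 2 ∂P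

/-- The James–Stein shrinkage weight `w = min(1, σ²/dsq)` as a function of the squared
distance `dsq` to the shrinkage point, with `w = 1` when `dsq = 0`. -/
noncomputable def jsWeight (σsq dsq : ℝ) : ℝ :=
  if dsq = 0 then 1 else min 1 (σsq / dsq)

namespace GeodesicCAT0

variable {X : Type*} [MetricSpace X] (G : GeodesicCAT0 X)

lemma dist_left_γ (x y : X) {t : ℝ} (ht : t ∈ Set.Icc (0 : ℝ) 1) :
    dist x (G.γ x y t) = t * dist x y := by
  have h := G.dist_γ x y 0 ⟨le_rfl, zero_le_one⟩ t ht
  rwa [G.γ_zero, zero_sub, abs_neg, abs_of_nonneg ht.1] at h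

/-- First variation inequality, moving the reference point towards `o`. -/
lemma first_variation_lower (o x y : X) {l m s : ℝ} (hm : 0 ≤ m) (hml : m ≤ l) (hl : l ≤ 1)
    (hs : s ∈ Set.Icc (0 : ℝ) 1) :
    s * (dist x (G.γ o y l) ^ 2 - dist x (G.γ o y m) ^ 2) - s ^ 2 * dist x (G.γ o y l) ^ 2 ≤
      2 * (l - m) * dist o y *
        (dist o (G.γ o y l) - dist o (G.γ (G.γ o y l) x s)) := by
  have hl' : l ∈ Set.Icc (0 : ℝ) 1 := ⟨hm.trans hml, hl⟩
  have hm' : m ∈ Set.Icc (0 : ℝ) 1 := ⟨hm, hml.trans hl⟩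
  have hlm := G.dist_γ o y l hl' m hm'
  rw [abs_of_nonneg (sub_nonneg.2 hml)] at hlm
  have hcat := G.cat0 (G.γ o y l) x (G.γ o y m) s hs
  rw [hlm, dist_comm (G.γ o y l) x] at hcat
  have htri := dist_triangle o (G.γ o y m) (G.γ (G.γ o y l) x s)
  rw [dist_comm (G.γ o y m), G.dist_left_γ o y hm'] at htri
  rw [G.dist_left_γ o y hl']
  have hc : 0 ≤ (l - m) * dist o y := mul_nonneg (sub_nonneg.2 hml) dist_nonneg
  have h1 := mul_le_mul_of_nonneg_left htri hc
  have h2 := sq_nonneg (dist (G.γ (G.γ o y l) x s) (G.γ o y m) - (l - m) * dist o y)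
  have h3 := mul_nonneg hs.1 (sq_nonneg ((l - m) * dist o y))
  nlinarith

/-- First variation inequality, moving the reference point away from `o`. -/
lemma first_variation_upper (o x y : X) {l v s : ℝ} (hl : 0 ≤ l) (hlv : l ≤ v) (hv : v ≤ 1)
    (hs : s ∈ Set.Icc (0 : ℝ) 1) :
    2 * (v - l) * dist o y * (dist o (G.γ o y l) - dist o (G.γ (G.γ o y l) x s)) ≤
      s * (dist x (G.γ o y v) ^ 2 - dist x (G.γ o y l) ^ 2) +
        s ^ 2 * dist x (G.γ o y l) ^ 2 := by
  have hl' : l ∈ Set.Icc (0 : ℝ) 1 := ⟨hl, hlv.trans hv⟩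
  have hv' : v ∈ Set.Icc (0 : ℝ) 1 := ⟨hl.trans hlv, hv⟩
  have hlv' := G.dist_γ o y l hl' v hv'
  rw [abs_sub_comm, abs_of_nonneg (sub_nonneg.2 hlv)] at hlv'
  have hcat := G.cat0 (G.γ o y l) x (G.γ o y v) s hs
  rw [hlv', dist_comm (G.γ o y l) x] at hcat
  have htri := dist_triangle o (G.γ (G.γ o y l) x s) (G.γ o y v)
  rw [G.dist_left_γ o y hv'] at htri
  rw [G.dist_left_γ o y hl']
  have hc : 0 ≤ (v - l) * dist o y := mul_nonneg (sub_nonneg.2 hlv) dist_nonneg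
  have h1 := mul_le_mul_of_nonneg_left htri hc
  have h2 := sq_nonneg (dist (G.γ (G.γ o y l) x s) (G.γ o y v) - (v - l) * dist o y)
  have h3 := mul_nonneg hs.1 (sq_nonneg ((v - l) * dist o y))
  nlinarith

/-- A Riemann sum approximating `dist x y ^ 2 - dist o x ^ 2`, built only from geodesics and
distances to the fixed point `o`. -/
noncomputable def variationSum (o : X) (n : ℕ) (x y : X) : ℝ :=
  ∑ k ∈ Finset.range n, 2 * (1 / ((n : ℝ) + 1)) * dist o y *
    (dist o (G.γ o y ((k + 1) / ((n : ℝ) + 1))) -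
      dist o (G.γ (G.γ o y ((k + 1) / ((n : ℝ) + 1))) x ((1 / ((n : ℝ) + 1)) ^ 2))) *
    ((n : ℝ) + 1) ^ 2

lemma sum_sq_dist_le (o x y : X) (n : ℕ) :
    ∑ k ∈ Finset.range n,
        (1 / ((n : ℝ) + 1)) ^ 2 * dist x (G.γ o y ((k + 1) / ((n : ℝ) + 1))) ^ 2 ≤
      1 / ((n : ℝ) + 1) * (dist o x + dist o y) ^ 2 := by
  have hn : (0 : ℝ) < n + 1 := by positivity
  have hterm : ∀ k ∈ Finset.range n,
      (1 / ((n : ℝ) + 1)) ^ 2 * dist x (G.γ o y ((k + 1) / ((n : ℝ) + 1))) ^ 2 ≤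
        (1 / ((n : ℝ) + 1)) ^ 2 * (dist o x + dist o y) ^ 2 := by
    intro k hk
    have hk' : (k : ℝ) + 1 ≤ n := by exact_mod_cast Finset.mem_range.1 hk
    have hl : ((k : ℝ) + 1) / (n + 1) ∈ Set.Icc (0 : ℝ) 1 :=
      ⟨by positivity, (div_le_one hn).2 (by linarith)⟩
    have h := dist_triangle_left x (G.γ o y ((k + 1) / ((n : ℝ) + 1))) o
    rw [G.dist_left_γ o y hl] at h
    have h' : dist x (G.γ o y ((k + 1) / ((n : ℝ) + 1))) ≤ dist o x + dist o y :=
      h.trans (by gcongr; exact mul_le_of_le_one_left dist_nonneg hl.2)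
    gcongr
  refine (Finset.sum_le_sum hterm).trans ?_
  rw [Finset.sum_const, Finset.card_range, nsmul_eq_mul, ← mul_assoc]
  gcongr
  rw [div_pow, one_pow, mul_one_div, div_le_div_iff₀ (by positivity) hn]
  nlinarith

lemma le_variationSum (o x y : X) (n : ℕ) :
    dist x (G.γ o y (n / ((n : ℝ) + 1))) ^ 2 - dist o x ^ 2 -
        1 / ((n : ℝ) + 1) * (dist o x + dist o y) ^ 2 ≤ G.variationSum o n x y := by
  have hn : (0 : ℝ) < n + 1 := by positivity
  have htel := Finset.sum_range_sub
    (fun k : ℕ => dist x (G.γ o y ((k : ℝ) / ((n : ℝ) + 1))) ^ 2) n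
  simp only [Nat.cast_zero, zero_div, G.γ_zero, dist_comm x o] at htel
  rw [← htel]
  refine (sub_le_sub_left (G.sum_sq_dist_le o x y n) _).trans ?_
  rw [← Finset.sum_sub_distrib]
  refine Finset.sum_le_sum fun k hk => ?_
  have hk' : (k : ℝ) + 1 ≤ n := by exact_mod_cast Finset.mem_range.1 hk
  have hs : (1 / ((n : ℝ) + 1)) ^ 2 ∈ Set.Icc (0 : ℝ) 1 :=
    ⟨by positivity, pow_le_one₀ (by positivity) ((div_le_one hn).2 (by linarith))⟩
  have h := G.first_variation_lower o x y (l := ((k : ℝ) + 1) / (n + 1)) (m := (k : ℝ) / (n + 1))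
    (by positivity) (by gcongr; linarith) ((div_le_one hn).2 (by linarith)) hs
  rw [show ((k : ℝ) + 1) / (n + 1) - k / (n + 1) = 1 / (n + 1) by ring] at h
  have h' := mul_le_mul_of_nonneg_right h (sq_nonneg ((n : ℝ) + 1))
  have hinv : (1 / ((n : ℝ) + 1)) ^ 2 * ((n : ℝ) + 1) ^ 2 = 1 := by field_simp
  refine le_trans (le_of_eq ?_) h'
  push_cast
  linear_combination (-(dist x (G.γ o y (((k : ℝ) + 1) / (n + 1))) ^ 2 -
    dist x (G.γ o y ((k : ℝ) / (n + 1))) ^ 2) +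
    (1 / ((n : ℝ) + 1)) ^ 2 * dist x (G.γ o y (((k : ℝ) + 1) / (n + 1))) ^ 2) * hinv

lemma variationSum_le (o x y : X) (n : ℕ) :
    G.variationSum o n x y ≤ dist x y ^ 2 - dist x (G.γ o y (1 / ((n : ℝ) + 1))) ^ 2 +
      1 / ((n : ℝ) + 1) * (dist o x + dist o y) ^ 2 := by
  have hn : (0 : ℝ) < n + 1 := by positivity
  have htel := Finset.sum_range_sub
    (fun k : ℕ => dist x (G.γ o y (((k : ℝ) + 1) / ((n : ℝ) + 1))) ^ 2) n
  simp only [Nat.cast_zero, zero_add, div_self hn.ne', G.γ_one] at htel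
  rw [← htel]
  refine le_trans ?_ (add_le_add_right (G.sum_sq_dist_le o x y n) _)
  rw [← Finset.sum_add_distrib]
  refine Finset.sum_le_sum fun k hk => ?_
  have hk' : (k : ℝ) + 1 ≤ n := by exact_mod_cast Finset.mem_range.1 hk
  have hs : (1 / ((n : ℝ) + 1)) ^ 2 ∈ Set.Icc (0 : ℝ) 1 :=
    ⟨by positivity, pow_le_one₀ (by positivity) ((div_le_one hn).2 (by linarith))⟩
  have h := G.first_variation_upper o x y (l := ((k : ℝ) + 1) / (n + 1))
    (v := ((k : ℝ) + 1 + 1) / (n + 1))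
    (by positivity) (by gcongr; linarith) ((div_le_one hn).2 (by linarith)) hs
  rw [show ((k : ℝ) + 1 + 1) / (n + 1) - (k + 1) / (n + 1) = 1 / (n + 1) by ring] at h
  have h' := mul_le_mul_of_nonneg_right h (sq_nonneg ((n : ℝ) + 1))
  have hinv : (1 / ((n : ℝ) + 1)) ^ 2 * ((n : ℝ) + 1) ^ 2 = 1 := by field_simp
  refine h'.trans (le_of_eq ?_)
  push_cast
  linear_combination ((dist x (G.γ o y (((k : ℝ) + 1 + 1) / (n + 1))) ^ 2 -
    dist x (G.γ o y (((k : ℝ) + 1) / (n + 1))) ^ 2) +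
    (1 / ((n : ℝ) + 1)) ^ 2 * dist x (G.γ o y (((k : ℝ) + 1) / (n + 1))) ^ 2) * hinv

lemma continuousOn_γ (x y : X) : ContinuousOn (G.γ x y) (Set.Icc 0 1) := by
  refine (LipschitzOnWith.of_dist_le_mul (K := (dist x y).toNNReal) fun s hs t ht => ?_).continuousOn
  rw [G.dist_γ x y s hs t ht, Real.coe_toNNReal _ dist_nonneg, Real.dist_eq, mul_comm]

lemma tendsto_variationSum (o x y : X) :
    Tendsto (fun n => G.variationSum o n x y) atTop (nhds (dist x y ^ 2 - dist o x ^ 2)) := by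
  have hcont : ContinuousOn (fun t => dist x (G.γ o y t) ^ 2) (Set.Icc 0 1) :=
    ((continuous_const.dist continuous_id).comp_continuousOn (G.continuousOn_γ o y)).pow 2
  have hinv : Tendsto (fun n : ℕ => 1 / ((n : ℝ) + 1)) atTop (nhds 0) :=
    tendsto_one_div_add_atTop_nhds_zero_nat
  have herr : Tendsto (fun n : ℕ => 1 / ((n : ℝ) + 1) * (dist o x + dist o y) ^ 2) atTop
      (nhds 0) := by
    simpa using hinv.mul_const ((dist o x + dist o y) ^ 2)
  have hzero : Tendsto (fun n : ℕ => dist x (G.γ o y (1 / ((n : ℝ) + 1))) ^ 2) atTop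
      (nhds (dist o x ^ 2)) := by
    have h := (hcont 0 ⟨le_rfl, zero_le_one⟩).tendsto.comp
      (tendsto_nhdsWithin_iff.2 ⟨hinv, Eventually.of_forall fun n : ℕ =>
        ⟨by positivity, (div_le_one (by positivity)).2 (by simp)⟩⟩)
    simpa [G.γ_zero, dist_comm x o, Function.comp_def] using h
  have hone : Tendsto (fun n : ℕ => dist x (G.γ o y (n / ((n : ℝ) + 1))) ^ 2) atTop
      (nhds (dist x y ^ 2)) := by
    have h := (hcont 1 ⟨zero_le_one, le_rfl⟩).tendsto.comp
      (tendsto_nhdsWithin_iff.2 ⟨tendsto_natCast_div_add_atTop (1 : ℝ),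
        Eventually.of_forall fun n : ℕ =>
        ⟨by positivity, (div_le_one (by positivity)).2 (by simp)⟩⟩)
    simpa [G.γ_one, Function.comp_def] using h
  refine tendsto_of_tendsto_of_tendsto_of_le_of_le ?_ ?_ (G.le_variationSum o x y)
    (G.variationSum_le o x y)
  · simpa using (hone.sub_const (dist o x ^ 2)).sub herr
  · simpa using (hzero.const_sub (dist x y ^ 2)).add herr

variable {G}

/-- No separability is assumed: measurability of the distance for the product σ-algebra is a
consequence of measurability of the geodesic map. -/
lemma MeasurableGeo.measurable_sq_dist [MeasurableSpace X] [BorelSpace X]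
    (hG : G.MeasurableGeo) : Measurable fun p : X × X => dist p.1 p.2 ^ 2 := by
  rcases isEmpty_or_nonempty X with hX | ⟨⟨o⟩⟩
  · exact measurable_of_empty _
  have ho : Measurable fun x : X => dist o x := (continuous_const.dist continuous_id).measurable
  have hγ : ∀ {f g : X × X → X} (t : ℝ), Measurable f → Measurable g →
      Measurable fun p => G.γ (f p) (g p) t := fun t hf hg =>
    hG.comp (hf.prodMk (hg.prodMk measurable_const))
  have hsum : ∀ n, Measurable fun p : X × X => G.variationSum o n p.1 p.2 := by
    intro n
    refine Finset.measurable_fun_sum _ fun k _ => ?_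
    have hp := hγ (((k : ℝ) + 1) / ((n : ℝ) + 1)) (measurable_const (a := o)) measurable_snd
    exact (((ho.comp measurable_snd).const_mul _).mul
      ((ho.comp hp).sub (ho.comp (hγ _ hp measurable_fst)))).mul_const _
  have hlim : Measurable fun p : X × X => dist p.1 p.2 ^ 2 - dist o p.1 ^ 2 :=
    measurable_of_tendsto_metrizable hsum
      (tendsto_pi_nhds.2 fun p => G.tendsto_variationSum o p.1 p.2)
  have h := hlim.add ((ho.comp measurable_fst).pow_const 2)
  simpa only [Pi.add_def, Function.comp_apply, sub_add_cancel] using h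

lemma MeasurableGeo.integrable_sq_dist [MeasurableSpace X] [BorelSpace X]
    (hG : G.MeasurableGeo) {Ω : Type*} [MeasurableSpace Ω] {P : Measure Ω} {f g : Ω → X}
    (hf : Measurable f) (hg : Measurable g) (z : X)
    (hfz : Integrable (fun ω => dist z (f ω) ^ 2) P)
    (hgz : Integrable (fun ω => dist z (g ω) ^ 2) P) :
    Integrable (fun ω => dist (f ω) (g ω) ^ 2) P := by
  refine ((hfz.const_mul 2).add (hgz.const_mul 2)).mono'
    (hG.measurable_sq_dist.comp (hf.prodMk hg)).aestronglyMeasurable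
    (Eventually.of_forall fun ω => ?_)
  have h := dist_triangle_left (f ω) (g ω) z
  have h0 : 0 ≤ dist (f ω) (g ω) := dist_nonneg
  rw [Real.norm_of_nonneg (sq_nonneg _), Pi.add_apply]
  nlinarith [sq_nonneg (dist z (f ω) - dist z (g ω))]

end GeodesicCAT0

/-- the projection inequality in `L²(𝒳)` for a CAT(0) space `𝒳`.
If `δ̃` minimizes `Y ↦ E[d(δ,Y)²]` over a geodesically convex class `𝒞` of random
objects containing all constants, then for every `θ ∈ 𝒳`,
`E[d(δ,θ)²] ≥ E[d(δ,δ̃)²] + E[d(δ̃,θ)²]`; in particular projecting onto `𝒞` never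
increases the squared-distance risk. -/
theorem projection_reduces_risk {X : Type*} [MetricSpace X] [MeasurableSpace X]
    [BorelSpace X]
    (G : GeodesicCAT0 X) (hG : G.MeasurableGeo)
    {Ω : Type*} [MeasurableSpace Ω] (P : Measure Ω) [IsProbabilityMeasure P]
    (δ : Ω → X) (hδ : Measurable δ)
    (hδint : ∀ z : X, Integrable (fun ω => dist z (δ ω) ^ 2) P)
    (C : Set (Ω → X))
    (hCmeas : ∀ Y ∈ C, Measurable Y)
    (hCint : ∀ Y ∈ C, ∀ z : X, Integrable (fun ω => dist z (Y ω) ^ 2) P)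
    (hCconv : ∀ Y₁ ∈ C, ∀ Y₂ ∈ C, ∀ t ∈ Set.Icc (0:ℝ) 1,
      (fun ω => G.γ (Y₁ ω) (Y₂ ω) t) ∈ C)
    (hCconst : ∀ z : X, (fun _ : Ω => z) ∈ C)
    (δt : Ω → X) (hδt : δt ∈ C)
    (hmin : ∀ Y ∈ C, ∫ ω, dist (δ ω) (δt ω) ^ 2 ∂P ≤ ∫ ω, dist (δ ω) (Y ω) ^ 2 ∂P) :
    ∀ θ : X,
      (∫ ω, dist (δ ω) (δt ω) ^ 2 ∂P + ∫ ω, dist (δt ω) θ ^ 2 ∂P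
          ≤ ∫ ω, dist (δ ω) θ ^ 2 ∂P) ∧
      ∫ ω, dist (δt ω) θ ^ 2 ∂P ≤ ∫ ω, dist (δ ω) θ ^ 2 ∂P := by
  intro θ
  have hδt_meas := hCmeas δt hδt
  have hδθ : Integrable (fun ω => dist (δ ω) θ ^ 2) P := by
    simpa only [dist_comm] using hδint θ
  have hδtθ : Integrable (fun ω => dist (δt ω) θ ^ 2) P := by
    simpa only [dist_comm] using hCint δt hδt θ
  have hδδt : Integrable (fun ω => dist (δ ω) (δt ω) ^ 2) P :=
    hG.integrable_sq_dist hδ hδt_meas θ (hδint θ) (hCint δt hδt θ)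
  have hstep : ∀ t ∈ Set.Ioo (0 : ℝ) 1,
      ∫ ω, dist (δ ω) (δt ω) ^ 2 ∂P + (1 - t) * ∫ ω, dist (δt ω) θ ^ 2 ∂P
        ≤ ∫ ω, dist (δ ω) θ ^ 2 ∂P := by
    intro t ht
    have hYC := hCconv δt hδt _ (hCconst θ) t (Set.Ioo_subset_Icc_self ht)
    have hY := hG.integrable_sq_dist hδ (hCmeas _ hYC) θ (hδint θ) (hCint _ hYC θ)
    have hle : ∫ ω, dist (δ ω) (G.γ (δt ω) θ t) ^ 2 ∂P ≤
        ∫ ω, ((1 - t) * dist (δ ω) (δt ω) ^ 2 + t * dist (δ ω) θ ^ 2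
          - t * (1 - t) * dist (δt ω) θ ^ 2) ∂P := by
      refine integral_mono hY (((hδδt.const_mul _).add (hδθ.const_mul _)).sub
        (hδtθ.const_mul _)) fun ω => ?_
      simpa only [dist_comm (δ ω)] using
        G.cat0 (δt ω) θ (δ ω) t (Set.Ioo_subset_Icc_self ht)
    rw [integral_sub (by exact (hδδt.const_mul _).add (hδθ.const_mul _)) (hδtθ.const_mul _),
      integral_add (hδδt.const_mul _) (hδθ.const_mul _), integral_const_mul,
      integral_const_mul, integral_const_mul] at hle
    have h := (hmin _ hYC).trans hle
    refine le_of_mul_le_mul_left ?_ ht.1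
    linarith
  have hmain : ∫ ω, dist (δ ω) (δt ω) ^ 2 ∂P + ∫ ω, dist (δt ω) θ ^ 2 ∂P
      ≤ ∫ ω, dist (δ ω) θ ^ 2 ∂P := by
    have hlim : Tendsto (fun t : ℝ => ∫ ω, dist (δ ω) (δt ω) ^ 2 ∂P
        + (1 - t) * ∫ ω, dist (δt ω) θ ^ 2 ∂P) (nhdsWithin 0 (Set.Ioi 0))
        (nhds (∫ ω, dist (δ ω) (δt ω) ^ 2 ∂P + (1 - 0) * ∫ ω, dist (δt ω) θ ^ 2 ∂P)) :=
      (Continuous.tendsto (by fun_prop) 0).mono_left nhdsWithin_le_nhds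
    rw [sub_zero, one_mul] at hlim
    exact le_of_tendsto hlim
      (eventually_of_mem (Ioo_mem_nhdsGT zero_lt_one) hstep)
  have hnonneg : 0 ≤ ∫ ω, dist (δ ω) (δt ω) ^ 2 ∂P :=
    integral_nonneg fun ω => sq_nonneg _
  exact ⟨hmain, by linarith⟩
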